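/- Let Π₀ = {{1,2},{3,4},...,{2k−1,2k}} and let Π₁ be the perfect matching of {1,...,2k} corresponding to two cycles of lengths 2k₁ and 2k₂ (k = k₁ + k₂, r = 2). Then the partitions Π ∈ Part₂(2k) satisfying #(Π₁ ∨ Π) = 1 and #(Π₀ ∨ Π) = k − 1 are exactly those obtained by choosing parts A ∈ Π₀ with A ⊂ {1,...,2k₁} and A' ∈ Π₀ with A' ⊂ {2k₁+1,...,2k} and forming one of three partitions: (Π₀∖{A,A'}) ∪ {{min A, min A'},{max A, max A'}}, (Π₀∖{A,A'}) ∪ {{min A, max A'},{max A, min A'}}, or (Π₀∖{A,A'}) ∪ {A∪A'}. In particular there are exactly 3·k₁·k₂ such partitions Π. -/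

import Mathlib

open Finset
open scoped Classical

/-- `P` is a set partition of the finite set `s`. -/
def IsPartitionOf {α : Type*} (s : Finset α) (P : Finset (Finset α)) : Prop :=
  (∀ A ∈ P, A ⊆ s) ∧ (∀ A ∈ P, A.Nonempty) ∧ ∀ x ∈ s, ∃! A, A ∈ P ∧ x ∈ A

/-- The finite set of all set partitions of `s`. -/
noncomputable def partitionsOf {α : Type*} [DecidableEq α] (s : Finset α) :
    Finset (Finset (Finset α)) :=
  s.powerset.powerset.filter fun P => IsPartitionOf s P

/-- The equivalence relation generated by a family of parts. -/
noncomputable def toSetoid (P : Finset (Finset ℕ)) : Setoid ℕ :=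
  sInf {S : Setoid ℕ | ∀ A ∈ P, ∀ x ∈ A, ∀ y ∈ A, S.r x y}

/-- The number of parts of the join `P ∨ Q` of two partitions of `s`:
the number of equivalence classes meeting `s` of the equivalence relation
generated by the parts of `P` and of `Q`. -/
noncomputable def joinNumParts (s : Finset ℕ) (P Q : Finset (Finset ℕ)) : ℕ :=
  Nat.card (Set.range fun x : s => Quotient.mk (toSetoid (P ∪ Q)) (x : ℕ))


lemma mem_partitionsOf' {s : Finset ℕ} {P : Finset (Finset ℕ)} :
    P ∈ partitionsOf s ↔ IsPartitionOf s P := by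
  unfold partitionsOf
  rw [Finset.mem_filter]
  constructor
  · exact fun h => h.2
  · intro h
    refine ⟨?_, h⟩
    rw [Finset.mem_powerset]
    intro A hA
    rw [Finset.mem_powerset]
    exact h.1 A hA

lemma part_eq_of_subset {s : Finset ℕ} {P Q : Finset (Finset ℕ)} (hP : IsPartitionOf s P)
    (hQ : IsPartitionOf s Q) (h : Q ⊆ P) : P = Q := by
  apply Finset.Subset.antisymm _ h
  intro A hA
  obtain ⟨x, hx⟩ := hP.2.1 A hA
  have hxs := hP.1 A hA hx
  obtain ⟨B, ⟨hB, hxB⟩, -⟩ := hQ.2.2 x hxs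
  have := (hP.2.2 x hxs).unique ⟨hA, hx⟩ ⟨h hB, hxB⟩
  rw [this]; exact hB

lemma toSetoid_of_mem {P : Finset (Finset ℕ)} {A : Finset ℕ} (hA : A ∈ P) {x y : ℕ}
    (hx : x ∈ A) (hy : y ∈ A) : (toSetoid P).r x y := by
  intro S hS
  exact hS A hA x hx y hy

lemma toSetoid_const {α : Type*} {P : Finset (Finset ℕ)} (g : ℕ → α)
    (hg : ∀ A ∈ P, ∀ x ∈ A, ∀ y ∈ A, g x = g y) {x y : ℕ} (h : (toSetoid P).r x y) :
    g x = g y :=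
  h (Setoid.ker g) hg

lemma joinNumParts_eq (s : Finset ℕ) (P Q : Finset (Finset ℕ)) :
    joinNumParts s P Q = (s.image fun x => Quotient.mk (toSetoid (P ∪ Q)) x).card := by
  unfold joinNumParts
  rw [← Set.ncard_coe_finset, ← Nat.card_coe_set_eq, Finset.coe_image, Set.image_eq_range]
  rfl

lemma joinNumParts_of {s : Finset ℕ} {P Q : Finset (Finset ℕ)} (g : ℕ → ℕ)
    (hg : ∀ A ∈ P ∪ Q, ∀ x ∈ A, ∀ y ∈ A, g x = g y)
    (hg' : ∀ x ∈ s, ∀ y ∈ s, g x = g y → (toSetoid (P ∪ Q)).r x y) :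
    joinNumParts s P Q = (s.image g).card := by
  rw [joinNumParts_eq]
  have : s.image g = (s.image fun x => Quotient.mk (toSetoid (P ∪ Q)) x).image
      (Quotient.lift g (fun a b h => toSetoid_const g hg h)) := by
    rw [Finset.image_image]; rfl
  rw [this]
  symm
  apply Finset.card_image_of_injOn
  intro a ha b hb hab
  simp only [Finset.coe_image, Set.mem_image, Finset.mem_coe] at ha hb
  obtain ⟨x, hx, rfl⟩ := ha
  obtain ⟨y, hy, rfl⟩ := hb
  exact Quotient.sound (hg' x hx y hy hab)

def bb (u : ℕ) : Finset ℕ := {2 * u - 1, 2 * u}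

def NN (i t t' : ℕ) : Finset (Finset ℕ) :=
  if i = 0 then {{2 * t - 1, 2 * t' - 1}, {2 * t, 2 * t'}}
  else if i = 1 then {{2 * t - 1, 2 * t'}, {2 * t, 2 * t' - 1}}
  else {{2 * t - 1, 2 * t, 2 * t' - 1, 2 * t'}}

noncomputable def QQ (k i t t' : ℕ) : Finset (Finset ℕ) :=
  ((Finset.Icc 1 k).image bb \ {bb t, bb t'}) ∪ NN i t t'

lemma mem_bb {u x : ℕ} (hu : 1 ≤ u) : x ∈ bb u ↔ 1 ≤ x ∧ (x + 1) / 2 = u := by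
  simp only [bb, Finset.mem_insert, Finset.mem_singleton]; omega

lemma bb_inj {u v : ℕ} (hu : 1 ≤ u) (hv : 1 ≤ v) (h : bb u = bb v) : u = v := by
  have : 2 * u ∈ bb v := by rw [← h, mem_bb hu]; omega
  rw [mem_bb hv] at this; omega

lemma mem_QQ {k i t t' : ℕ} (ht : 1 ≤ t) (ht' : 1 ≤ t') {A : Finset ℕ} :
    A ∈ QQ k i t t' ↔ (∃ u, 1 ≤ u ∧ u ≤ k ∧ u ≠ t ∧ u ≠ t' ∧ A = bb u) ∨ A ∈ NN i t t' := by
  simp only [QQ, Finset.mem_union, Finset.mem_sdiff, Finset.mem_image, Finset.mem_Icc,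
    Finset.mem_insert, Finset.mem_singleton]
  apply or_congr _ Iff.rfl
  constructor
  · rintro ⟨⟨u, hu, rfl⟩, h⟩
    refine ⟨u, hu.1, hu.2, ?_, ?_, rfl⟩ <;> rintro rfl <;> simp at h
  · rintro ⟨u, h1, h2, h3, h4, rfl⟩
    refine ⟨⟨u, ⟨h1, h2⟩, rfl⟩, ?_⟩
    rintro (h | h)
    · exact h3 (bb_inj h1 ht h)
    · exact h4 (bb_inj h1 ht' h)

lemma NN_blk {i t t' x : ℕ} (ht : 1 ≤ t) (ht' : 1 ≤ t') {A : Finset ℕ} (hA : A ∈ NN i t t')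
    (hx : x ∈ A) : 1 ≤ x ∧ ((x + 1) / 2 = t ∨ (x + 1) / 2 = t') := by
  unfold NN at hA
  split_ifs at hA <;> simp only [Finset.mem_insert, Finset.mem_singleton] at hA
  · rcases hA with rfl | rfl <;> simp only [Finset.mem_insert, Finset.mem_singleton] at hx <;> omega
  · rcases hA with rfl | rfl <;> simp only [Finset.mem_insert, Finset.mem_singleton] at hx <;> omega
  · subst hA; simp only [Finset.mem_insert, Finset.mem_singleton] at hx; omega

lemma NN_ex {i t t' x : ℕ} (ht : 1 ≤ t) (htt : t < t') (hx : 1 ≤ x)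
    (h : (x + 1) / 2 = t ∨ (x + 1) / 2 = t') : ∃! A, A ∈ NN i t t' ∧ x ∈ A := by
  have hx : x = 2 * t - 1 ∨ x = 2 * t ∨ x = 2 * t' - 1 ∨ x = 2 * t' := by omega
  unfold NN
  split_ifs
  · by_cases h : x = 2 * t - 1 ∨ x = 2 * t' - 1
    · refine ⟨{2 * t - 1, 2 * t' - 1}, ⟨by simp, by simpa using h⟩, ?_⟩
      rintro A ⟨hA, hxA⟩
      simp only [Finset.mem_insert, Finset.mem_singleton] at hA
      rcases hA with rfl | rfl
      · rfl
      · simp only [Finset.mem_insert, Finset.mem_singleton] at hxA; omega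
    · refine ⟨{2 * t, 2 * t'}, ⟨by simp, by simp; omega⟩, ?_⟩
      rintro A ⟨hA, hxA⟩
      simp only [Finset.mem_insert, Finset.mem_singleton] at hA
      rcases hA with rfl | rfl
      · simp only [Finset.mem_insert, Finset.mem_singleton] at hxA; omega
      · rfl
  · by_cases h : x = 2 * t - 1 ∨ x = 2 * t'
    · refine ⟨{2 * t - 1, 2 * t'}, ⟨by simp, by simpa using h⟩, ?_⟩
      rintro A ⟨hA, hxA⟩
      simp only [Finset.mem_insert, Finset.mem_singleton] at hA
      rcases hA with rfl | rfl
      · rfl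
      · simp only [Finset.mem_insert, Finset.mem_singleton] at hxA; omega
    · refine ⟨{2 * t, 2 * t' - 1}, ⟨by simp, by simp; omega⟩, ?_⟩
      rintro A ⟨hA, hxA⟩
      simp only [Finset.mem_insert, Finset.mem_singleton] at hA
      rcases hA with rfl | rfl
      · simp only [Finset.mem_insert, Finset.mem_singleton] at hxA; omega
      · rfl
  · refine ⟨_, ⟨Finset.mem_singleton_self _, by simpa using hx⟩, ?_⟩
    rintro A ⟨hA, -⟩
    simpa using hA

lemma NN_card {i t t' : ℕ} (ht : 1 ≤ t) (htt : t < t') {A : Finset ℕ} (hA : A ∈ NN i t t') :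
    2 ≤ A.card := by
  have key : ∃ x ∈ A, ∃ y ∈ A, x ≠ y := by
    unfold NN at hA
    split_ifs at hA <;> simp only [Finset.mem_insert, Finset.mem_singleton] at hA
    · rcases hA with rfl | rfl
      · exact ⟨2 * t - 1, by simp, 2 * t' - 1, by simp, by omega⟩
      · exact ⟨2 * t, by simp, 2 * t', by simp, by omega⟩
    · rcases hA with rfl | rfl
      · exact ⟨2 * t - 1, by simp, 2 * t', by simp, by omega⟩
      · exact ⟨2 * t, by simp, 2 * t' - 1, by simp, by omega⟩
    · subst hA
      exact ⟨2 * t, by simp, 2 * t', by simp, by omega⟩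
  obtain ⟨x, hx, y, hy, h⟩ := key
  exact Finset.one_lt_card.mpr ⟨x, hx, y, hy, h⟩

lemma NN_bridge {i t t' : ℕ} : ∃ A ∈ NN i t t', 2 * t ∈ A ∧ (2 * t' ∈ A ∨ 2 * t' - 1 ∈ A) := by
  unfold NN
  split_ifs
  · exact ⟨{2 * t, 2 * t'}, by simp, by simp, by simp⟩
  · exact ⟨{2 * t, 2 * t' - 1}, by simp, by simp, by simp⟩
  · exact ⟨_, Finset.mem_singleton_self _, by simp, by simp⟩

lemma QQ_part {k i t t' : ℕ} (ht : 1 ≤ t) (htt : t < t') (htk : t' ≤ k) :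
    IsPartitionOf (Finset.Icc 1 (2 * k)) (QQ k i t t') := by
  have ht' : 1 ≤ t' := by omega
  refine ⟨?_, ?_, ?_⟩
  · intro A hA x hx
    rw [Finset.mem_Icc]
    rcases (mem_QQ ht ht').1 hA with ⟨u, h1, h2, h3, h4, rfl⟩ | hA
    · rw [mem_bb h1] at hx; omega
    · have := NN_blk ht ht' hA hx; omega
  · intro A hA
    rcases (mem_QQ ht ht').1 hA with ⟨u, h1, h2, h3, h4, rfl⟩ | hA
    · exact ⟨2 * u, by simp [bb]⟩
    · have := NN_card ht htt hA
      exact Finset.card_pos.1 (by omega)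
  · intro x hx
    rw [Finset.mem_Icc] at hx
    by_cases h : (x + 1) / 2 = t ∨ (x + 1) / 2 = t'
    · obtain ⟨A, ⟨hA, hxA⟩, hu⟩ := NN_ex (i := i) ht htt hx.1 h
      refine ⟨A, ⟨(mem_QQ ht ht').2 (Or.inr hA), hxA⟩, ?_⟩
      rintro B ⟨hB, hxB⟩
      rcases (mem_QQ ht ht').1 hB with ⟨u, h1, h2, h3, h4, rfl⟩ | hB
      · rw [mem_bb h1] at hxB; omega
      · exact hu B ⟨hB, hxB⟩
    · refine ⟨bb ((x + 1) / 2), ⟨(mem_QQ ht ht').2 (Or.inl ⟨_, ?_, ?_, ?_, ?_, rfl⟩), ?_⟩, ?_⟩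
      any_goals omega
      · rw [mem_bb (by omega)]; omega
      · rintro B ⟨hB, hxB⟩
        rcases (mem_QQ ht ht').1 hB with ⟨u, h1, h2, h3, h4, rfl⟩ | hB
        · rw [mem_bb h1] at hxB; rw [hxB.2]
        · have := NN_blk ht ht' hB hxB; omega

lemma QQ_card {k i t t' : ℕ} (ht : 1 ≤ t) (htt : t < t') {A : Finset ℕ} (hA : A ∈ QQ k i t t') :
    2 ≤ A.card := by
  rcases (mem_QQ ht (by omega)).1 hA with ⟨u, h1, h2, h3, h4, rfl⟩ | hA
  · exact Finset.one_lt_card.mpr ⟨2 * u - 1, by simp [bb], 2 * u, by simp [bb], by omega⟩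
  · exact NN_card ht htt hA

lemma QQ_join0 {k i t t' : ℕ} (ht : 1 ≤ t) (htt : t < t') (htk : t' ≤ k) :
    joinNumParts (Finset.Icc 1 (2 * k)) ((Finset.Icc 1 k).image bb) (QQ k i t t') = k - 1 := by
  have ht' : 1 ≤ t' := by omega
  set R := toSetoid ((Finset.Icc 1 k).image bb ∪ QQ k i t t') with hR
  have hb : ∀ x, 1 ≤ x → x ≤ 2 * k → R.r x (2 * ((x + 1) / 2)) := by
    intro x h1 h2
    refine toSetoid_of_mem (A := bb ((x + 1) / 2)) ?_ ?_ ?_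
    · exact Finset.mem_union_left _ (Finset.mem_image_of_mem _ (Finset.mem_Icc.2 (by omega)))
    · rw [mem_bb] <;> omega
    · rw [mem_bb] <;> omega
  have htr : R.r (2 * t') (2 * t) := by
    obtain ⟨A, hA, h1, h2⟩ := NN_bridge (i := i) (t := t) (t' := t')
    have hA' := Finset.mem_union_right ((Finset.Icc 1 k).image bb)
      ((mem_QQ (k := k) ht ht').2 (Or.inr hA))
    rcases h2 with h2 | h2
    · exact toSetoid_of_mem hA' h2 h1
    · have h3 := hb (2 * t' - 1) (by omega) (by omega)
      rw [show 2 * ((2 * t' - 1 + 1) / 2) = 2 * t' by omega] at h3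
      exact R.trans' (R.symm' h3) (toSetoid_of_mem hA' h2 h1)
  rw [joinNumParts_of (fun x => if (x + 1) / 2 = t' then t else (x + 1) / 2)]
  · have : (Finset.Icc 1 (2 * k)).image (fun x => if (x + 1) / 2 = t' then t else (x + 1) / 2)
        = (Finset.Icc 1 k).erase t' := by
      ext u
      simp only [Finset.mem_image, Finset.mem_Icc, Finset.mem_erase]
      constructor
      · rintro ⟨x, hx, rfl⟩
        split_ifs <;> omega
      · rintro ⟨h1, h2, h3⟩
        refine ⟨2 * u, by omega, ?_⟩
        rw [if_neg] <;> omega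
    rw [this, Finset.card_erase_of_mem (Finset.mem_Icc.2 ⟨ht', htk⟩)]
    simp
  · intro A hA x hx y hy
    have : (A ∈ NN i t t') ∨ ∃ u, 1 ≤ u ∧ A = bb u := by
      rcases Finset.mem_union.1 hA with hA | hA
      · obtain ⟨u, hu, rfl⟩ := Finset.mem_image.1 hA
        exact Or.inr ⟨u, (Finset.mem_Icc.1 hu).1, rfl⟩
      · rcases (mem_QQ ht ht').1 hA with ⟨u, h1, h2, h3, h4, rfl⟩ | hA
        · exact Or.inr ⟨u, h1, rfl⟩
        · exact Or.inl hA
    rcases this with hA | ⟨u, hu, rfl⟩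
    · have h1 := NN_blk ht ht' hA hx
      have h2 := NN_blk ht ht' hA hy
      split_ifs <;> omega
    · rw [mem_bb hu] at hx hy
      simp only [hx.2, hy.2]
  · intro x hx y hy hxy
    rw [Finset.mem_Icc] at hx hy
    have key : ∀ x, 1 ≤ x → x ≤ 2 * k →
        R.r x (2 * (if (x + 1) / 2 = t' then t else (x + 1) / 2)) := by
      intro x h1 h2
      split_ifs with h
      · have := hb x h1 h2
        rw [h] at this
        exact R.trans' this htr
      · exact hb x h1 h2
    have h1 := key x hx.1 hx.2
    have h2 := key y hy.1 hy.2
    rw [hxy] at h1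
    exact R.trans' h1 (R.symm' h2)

lemma cyc (R : Setoid ℕ) (c m t : ℕ) (ht : 1 ≤ t) (htm : t ≤ m)
    (h1 : ∀ u, 1 ≤ u → u < m → R.r (c + 2 * u) (c + 2 * u + 1))
    (h2 : R.r (c + 2 * m) (c + 1))
    (h3 : ∀ u, 1 ≤ u → u ≤ m → u ≠ t → R.r (c + 2 * u - 1) (c + 2 * u)) :
    ∀ x, 1 ≤ x → x ≤ 2 * m → R.r (c + 2 * t) (c + x) := by
  have step : ∀ x, 1 ≤ x → x < 2 * m → x ≠ 2 * t - 1 → R.r (c + x) (c + x + 1) := by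
    intro x hx1 hx2 hx3
    rcases Nat.even_or_odd' x with ⟨u, rfl | rfl⟩
    · exact h1 u (by omega) (by omega)
    · have := h3 (u + 1) (by omega) (by omega) (by omega)
      rw [show c + 2 * (u + 1) - 1 = c + (2 * u + 1) by omega,
        show c + 2 * (u + 1) = c + (2 * u + 1) + 1 by omega] at this
      exact this
  have up : ∀ x, 2 * t ≤ x → x ≤ 2 * m → R.r (c + 2 * t) (c + x) := by
    intro x hx
    induction x, hx using Nat.le_induction with
    | base => intro _; exact R.refl' _
    | succ n hn ih =>
      intro h
      exact R.trans' (ih (by omega)) (step n (by omega) (by omega) (by omega))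
  have lo : ∀ x, 1 ≤ x → x ≤ 2 * t - 1 → R.r (c + 1) (c + x) := by
    intro x hx
    induction x, hx using Nat.le_induction with
    | base => intro _; exact R.refl' _
    | succ n hn ih =>
      intro h
      exact R.trans' (ih (by omega)) (step n (by omega) (by omega) (by omega))
  intro x hx1 hx2
  by_cases h : 2 * t ≤ x
  · exact up x h hx2
  · exact R.trans' (R.trans' (up (2 * m) (by omega) le_rfl) h2) (lo x hx1 (by omega))

noncomputable def PP (k₁ k₂ k : ℕ) : Finset (Finset ℕ) :=
  (((Finset.Icc 1 (k₁ - 1)).image fun t => ({2 * t, 2 * t + 1} : Finset ℕ)) ∪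
        {({2 * k₁, 1} : Finset ℕ)}) ∪
      ((((Finset.Icc 1 (k₂ - 1)).image fun t =>
          ({2 * k₁ + 2 * t, 2 * k₁ + 2 * t + 1} : Finset ℕ)) ∪
        {({2 * k, 2 * k₁ + 1} : Finset ℕ)}))

lemma mem_PP {k₁ k₂ k : ℕ} {A : Finset ℕ} : A ∈ PP k₁ k₂ k ↔
    (∃ u, 1 ≤ u ∧ u ≤ k₁ - 1 ∧ A = {2 * u, 2 * u + 1}) ∨ A = {2 * k₁, 1} ∨
    (∃ u, 1 ≤ u ∧ u ≤ k₂ - 1 ∧ A = {2 * k₁ + 2 * u, 2 * k₁ + 2 * u + 1}) ∨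
      A = {2 * k, 2 * k₁ + 1} := by
  simp only [PP, Finset.mem_union, Finset.mem_image, Finset.mem_Icc, Finset.mem_singleton,
    or_assoc, and_assoc, eq_comm]

lemma QQ_join1 {k₁ k₂ k i t t' : ℕ} (hk : k = k₁ + k₂) (ht : 1 ≤ t) (htt : t ≤ k₁)
    (hkt : k₁ < t') (htk : t' ≤ k) :
    joinNumParts (Finset.Icc 1 (2 * k)) (PP k₁ k₂ k) (QQ k i t t') = 1 := by
  have ht' : 1 ≤ t' := by omega
  set R := toSetoid (PP k₁ k₂ k ∪ QQ k i t t') with hR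
  have hb : ∀ u, 1 ≤ u → u ≤ k → u ≠ t → u ≠ t' → R.r (2 * u - 1) (2 * u) := by
    intro u h1 h2 h3 h4
    exact toSetoid_of_mem (A := bb u) (Finset.mem_union_right _
      ((mem_QQ ht ht').2 (Or.inl ⟨u, h1, h2, h3, h4, rfl⟩))) (by simp [bb]) (by simp [bb])
  have hp : ∀ x y, ({x, y} : Finset ℕ) ∈ PP k₁ k₂ k → R.r x y := by
    intro x y h
    exact toSetoid_of_mem (Finset.mem_union_left _ h) (by simp) (by simp)
  have c1 := cyc R 0 k₁ t ht htt
    (by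
      intro u h1 h2
      rw [Nat.zero_add]
      exact hp _ _ (mem_PP.2 (Or.inl ⟨u, h1, by omega, rfl⟩)))
    (by
      rw [Nat.zero_add, Nat.zero_add]
      exact hp _ _ (mem_PP.2 (Or.inr (Or.inl rfl))))
    (by
      intro u h1 h2 h3
      rw [Nat.zero_add]
      exact hb u h1 (by omega) h3 (by omega))
  have c2 := cyc R (2 * k₁) k₂ (t' - k₁) (by omega) (by omega)
    (by
      intro u h1 h2
      exact hp _ _ (mem_PP.2 (Or.inr (Or.inr (Or.inl ⟨u, h1, by omega, rfl⟩)))))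
    (by
      rw [show 2 * k₁ + 2 * k₂ = 2 * k by omega]
      exact hp _ _ (mem_PP.2 (Or.inr (Or.inr (Or.inr rfl)))))
    (by
      intro u h1 h2 h3
      rw [show 2 * k₁ + 2 * u = 2 * (k₁ + u) by omega]
      exact hb _ (by omega) (by omega) (by omega) (by omega))
  rw [show 2 * k₁ + 2 * (t' - k₁) = 2 * t' by omega] at c2
  simp only [Nat.zero_add] at c1
  have br : R.r (2 * t) (2 * t') := by
    obtain ⟨A, hA, h1, h2⟩ := NN_bridge (i := i) (t := t) (t' := t')
    have hA' := Finset.mem_union_right (PP k₁ k₂ k)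
      ((mem_QQ (k := k) ht ht').2 (Or.inr hA))
    rcases h2 with h2 | h2
    · exact toSetoid_of_mem hA' h1 h2
    · have h3 := c2 (2 * t' - 1 - 2 * k₁) (by omega) (by omega)
      rw [show 2 * k₁ + (2 * t' - 1 - 2 * k₁) = 2 * t' - 1 by omega] at h3
      exact R.trans' (toSetoid_of_mem hA' h1 h2) (R.symm' h3)
  have all : ∀ x, 1 ≤ x → x ≤ 2 * k → R.r (2 * t) x := by
    intro x h1 h2
    by_cases h : x ≤ 2 * k₁
    · exact c1 x h1 h
    · have := c2 (x - 2 * k₁) (by omega) (by omega)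
      rw [show 2 * k₁ + (x - 2 * k₁) = x by omega] at this
      exact R.trans' br this
  rw [joinNumParts_of (fun _ => 0)]
  · rw [Finset.image_const, Finset.card_singleton]
    exact ⟨1, Finset.mem_Icc.2 (by omega)⟩
  · intros; rfl
  · intro x hx y hy _
    rw [Finset.mem_Icc] at hx hy
    exact R.trans' (R.symm' (all x hx.1 hx.2)) (all y hy.1 hy.2)

lemma merged {k : ℕ} (hk : 1 ≤ k) {P : Finset (Finset ℕ)}
    (hP : IsPartitionOf (Finset.Icc 1 (2 * k)) P)
    (hj : joinNumParts (Finset.Icc 1 (2 * k)) ((Finset.Icc 1 k).image bb) P = k - 1) :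
    ∃ t t', 1 ≤ t ∧ t < t' ∧ t' ≤ k ∧
      (toSetoid ((Finset.Icc 1 k).image bb ∪ P)).r (2 * t) (2 * t') ∧
      ∀ A ∈ P, ∀ x ∈ A, ∀ y ∈ A, (x + 1) / 2 = (y + 1) / 2 ∨
        ((x + 1) / 2 = t ∧ (y + 1) / 2 = t') ∨ ((x + 1) / 2 = t' ∧ (y + 1) / 2 = t) := by
  set R := toSetoid ((Finset.Icc 1 k).image bb ∪ P) with hR
  have hb : ∀ x, 1 ≤ x → x ≤ 2 * k → R.r x (2 * ((x + 1) / 2)) := by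
    intro x h1 h2
    refine toSetoid_of_mem (A := bb ((x + 1) / 2)) ?_ ?_ ?_
    · exact Finset.mem_union_left _ (Finset.mem_image_of_mem _ (Finset.mem_Icc.2 (by omega)))
    · rw [mem_bb] <;> omega
    · rw [mem_bb] <;> omega
  let f : ℕ → Quotient R := fun u => Quotient.mk R (2 * u)
  have hf : ∀ x, 1 ≤ x → x ≤ 2 * k → Quotient.mk R x = f ((x + 1) / 2) :=
    fun x h1 h2 => Quotient.sound (hb x h1 h2)
  rw [joinNumParts_eq] at hj
  have him : (Finset.Icc 1 (2 * k)).image (fun x => Quotient.mk R x)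
      = (Finset.Icc 1 k).image f := by
    ext q
    simp only [Finset.mem_image, Finset.mem_Icc]
    constructor
    · rintro ⟨x, hx, rfl⟩
      exact ⟨(x + 1) / 2, by omega, (hf x hx.1 hx.2).symm⟩
    · rintro ⟨u, hu, rfl⟩
      exact ⟨2 * u, by omega, rfl⟩
  rw [him] at hj
  have hex : ∃ t t', 1 ≤ t ∧ t < t' ∧ t' ≤ k ∧ f t = f t' := by
    obtain ⟨a, ha, b, hb, hab, h⟩ := Finset.exists_ne_map_eq_of_card_lt_of_maps_to
      (s := Finset.Icc 1 k) (t := (Finset.Icc 1 k).image f) (f := f)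
      (by rw [hj]; simp; omega) (fun x hx => Finset.mem_coe.2 (Finset.mem_image_of_mem f hx))
    rw [Finset.mem_Icc] at ha hb
    rcases lt_or_gt_of_ne hab with h' | h'
    · exact ⟨a, b, ha.1, h', hb.2, h⟩
    · exact ⟨b, a, hb.1, h', ha.2, h.symm⟩
  obtain ⟨t, t', h1, h2, h3, h4⟩ := hex
  have hinj : Set.InjOn f ((Finset.Icc 1 k).erase t' : Finset ℕ) := by
    rw [← Finset.card_image_iff]
    have : ((Finset.Icc 1 k).erase t').image f = (Finset.Icc 1 k).image f := by
      ext q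
      simp only [Finset.mem_image, Finset.mem_Icc, Finset.mem_erase]
      constructor
      · rintro ⟨u, hu, rfl⟩
        exact ⟨u, hu.2, rfl⟩
      · rintro ⟨u, hu, rfl⟩
        by_cases h : u = t'
        · exact ⟨t, by omega, by rw [h, h4]⟩
        · exact ⟨u, ⟨h, hu⟩, rfl⟩
    rw [this, hj, Finset.card_erase_of_mem (Finset.mem_Icc.2 (by omega))]
    simp
  refine ⟨t, t', h1, h2, h3, Quotient.exact h4, ?_⟩
  intro A hA x hx y hy
  have hx' := Finset.mem_Icc.1 (hP.1 A hA hx)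
  have hy' := Finset.mem_Icc.1 (hP.1 A hA hy)
  have hxy : f ((x + 1) / 2) = f ((y + 1) / 2) := by
    rw [← hf x hx'.1 hx'.2, ← hf y hy'.1 hy'.2]
    exact Quotient.sound (toSetoid_of_mem (Finset.mem_union_right _ hA) hx hy)
  have inj : ∀ u v, 1 ≤ u → u ≤ k → u ≠ t' → 1 ≤ v → v ≤ k → v ≠ t' → f u = f v → u = v := by
    intro u v a1 a2 a3 b1 b2 b3 h
    exact hinj (by simp; omega) (by simp; omega) h
  by_cases hxt : (x + 1) / 2 = t' <;> by_cases hyt : (y + 1) / 2 = t'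
  · left; omega
  · right; right
    refine ⟨hxt, ?_⟩
    rw [hxt, ← h4] at hxy
    exact (inj _ _ h1 (by omega) (by omega) (by omega) (by omega) hyt hxy).symm
  · right; left
    refine ⟨?_, hyt⟩
    rw [hyt, ← h4] at hxy
    exact inj _ _ (by omega) (by omega) hxt h1 (by omega) (by omega) hxy
  · left
    exact inj _ _ (by omega) (by omega) hxt (by omega) (by omega) hyt hxy

lemma pair_of_card {B : Finset ℕ} {x y : ℕ} (hB : 2 ≤ B.card) (h : ∀ z ∈ B, z = x ∨ z = y) :
    B = {x, y} := by
  apply Finset.eq_of_subset_of_card_le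
  · intro z hz
    simpa using h z hz
  · exact Finset.card_le_two.trans hB

lemma not_single {B : Finset ℕ} {x : ℕ} (hB : 2 ≤ B.card) (h : ∀ z ∈ B, z = x) : False := by
  obtain ⟨a, ha, b, hb, hab⟩ := Finset.one_lt_card.1 hB
  exact hab ((h a ha).trans (h b hb).symm)

lemma forward {k₁ k₂ k : ℕ} (hk₁ : 0 < k₁) (hk₂ : 0 < k₂) (hk : k = k₁ + k₂)
    {P : Finset (Finset ℕ)} (hP : IsPartitionOf (Finset.Icc 1 (2 * k)) P)
    (hc : ∀ A ∈ P, 2 ≤ A.card)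
    (hj1 : joinNumParts (Finset.Icc 1 (2 * k)) (PP k₁ k₂ k) P = 1)
    (hj : joinNumParts (Finset.Icc 1 (2 * k)) ((Finset.Icc 1 k).image bb) P = k - 1) :
    ∃ t t' i, 1 ≤ t ∧ t ≤ k₁ ∧ k₁ < t' ∧ t' ≤ k ∧ i < 3 ∧ P = QQ k i t t' := by
  obtain ⟨t, t', h1, h2, h3, hR, hm⟩ := merged (by omega) hP hj
  have hside : t ≤ k₁ ∧ k₁ < t' := by
    by_contra hcon
    rw [joinNumParts_eq, Finset.card_eq_one] at hj1
    obtain ⟨q, hq⟩ := hj1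
    have e : ∀ x ∈ Finset.Icc 1 (2 * k), Quotient.mk (toSetoid (PP k₁ k₂ k ∪ P)) x = q := by
      intro x hx
      have := Finset.mem_image_of_mem (fun x => Quotient.mk (toSetoid (PP k₁ k₂ k ∪ P)) x) hx
      rw [hq] at this
      simpa using this
    have r : (toSetoid (PP k₁ k₂ k ∪ P)).r 1 (2 * k₁ + 1) :=
      Quotient.exact ((e 1 (Finset.mem_Icc.2 (by omega))).trans
        (e (2 * k₁ + 1) (Finset.mem_Icc.2 (by omega))).symm)
    have := toSetoid_const (fun x => decide (x ≤ 2 * k₁)) ?_ r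
    · simp at this; omega
    · intro A hA x hx y hy
      rw [decide_eq_decide]
      rcases Finset.mem_union.1 hA with hA | hA
      · rcases mem_PP.1 hA with ⟨u, _, _, rfl⟩ | rfl | ⟨u, _, _, rfl⟩ | rfl <;>
          simp only [Finset.mem_insert, Finset.mem_singleton] at hx hy <;> omega
      · have := hm A hA x hx y hy
        omega
  have hex : ∀ x, 1 ≤ x → x ≤ 2 * k → ∃ A ∈ P, x ∈ A := by
    intro x a b
    obtain ⟨A, ⟨hA, hx⟩, -⟩ := hP.2.2 x (Finset.mem_Icc.2 ⟨a, b⟩)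
    exact ⟨A, hA, hx⟩
  have hdis : ∀ X ∈ P, ∀ Y ∈ P, ∀ x, x ∈ X → x ∈ Y → X = Y := by
    intro X hX Y hY x hx hy
    exact (hP.2.2 x (hP.1 X hX hx)).unique ⟨hX, hx⟩ ⟨hY, hy⟩
  have hpos : ∀ X ∈ P, ∀ x ∈ X, 1 ≤ x := fun X hX x hx => (Finset.mem_Icc.1 (hP.1 X hX hx)).1
  have hsing : ∀ u, 1 ≤ u → u ≤ k → u ≠ t → u ≠ t' → bb u ∈ P := by
    intro u u1 u2 u3 u4
    obtain ⟨A, hA, hx⟩ := hex (2 * u) (by omega) (by omega)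
    have : A = bb u := by
      apply pair_of_card (hc A hA)
      intro z hz
      have := hm A hA _ hx z hz
      have := hpos A hA z hz
      omega
    rw [← this]; exact hA
  have hNN : ∃ i < 3, ∀ A ∈ NN i t t', A ∈ P := by
    obtain ⟨A, hA, hb⟩ := hex (2 * t) (by omega) (by omega)
    have hfour : ∀ X ∈ P, ∀ x ∈ X, ((x + 1) / 2 = t ∨ (x + 1) / 2 = t') → ∀ y ∈ X,
        y = 2 * t - 1 ∨ y = 2 * t ∨ y = 2 * t' - 1 ∨ y = 2 * t' := by
      intro X hX x hx hxt y hy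
      have := hm X hX x hx y hy
      have := hpos X hX y hy
      omega
    have hA4 := hfour A hA _ hb (by omega)
    have hA2 := hc A hA
    by_cases ha : 2 * t - 1 ∈ A <;> by_cases hcc : 2 * t' - 1 ∈ A <;> by_cases hd : 2 * t' ∈ A
    · refine ⟨2, by omega, ?_⟩
      have : A = {2 * t - 1, 2 * t, 2 * t' - 1, 2 * t'} := by
        ext y
        simp only [Finset.mem_insert, Finset.mem_singleton]
        constructor
        · exact hA4 y
        · rintro (rfl | rfl | rfl | rfl) <;> assumption
      simp only [NN]
      intro B hB
      simp at hB
      rw [hB, ← this]; exact hA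
    · exfalso
      obtain ⟨B, hB, hx⟩ := hex (2 * t') (by omega) (by omega)
      have hB4 := hfour B hB _ hx (by omega)
      have hBA : ∀ z ∈ B, z ∉ A := fun z hz hz' => hd (hdis B hB A hA z hz hz' ▸ hx)
      refine not_single (x := 2 * t') (hc B hB) fun z hz => ?_
      have := hBA z hz
      rcases hB4 z hz with rfl | rfl | rfl | rfl <;> first | rfl | contradiction
    · exfalso
      obtain ⟨B, hB, hx⟩ := hex (2 * t' - 1) (by omega) (by omega)
      have hB4 := hfour B hB _ hx (by omega)
      have hBA : ∀ z ∈ B, z ∉ A := fun z hz hz' => hcc (hdis B hB A hA z hz hz' ▸ hx)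
      refine not_single (x := 2 * t' - 1) (hc B hB) fun z hz => ?_
      have := hBA z hz
      rcases hB4 z hz with rfl | rfl | rfl | rfl <;> first | rfl | contradiction
    · exfalso
      have := toSetoid_const (fun x => (x + 1) / 2) ?_ hR
      · omega
      · have key : ∀ X ∈ P, ∀ x ∈ X, ∀ y ∈ X, (x + 1) / 2 = t → (y + 1) / 2 = t' → False := by
          intro X hX x hx y hy hxt hyt
          have hxp := hpos X hX x hx
          have hyp := hpos X hX y hy
          have hxA : x ∈ A := by
            have : x = 2 * t - 1 ∨ x = 2 * t := by omega
            rcases this with rfl | rfl <;> assumption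
          have hyA : y ∈ A := hdis X hX A hA x hx hxA ▸ hy
          have : y = 2 * t' - 1 ∨ y = 2 * t' := by omega
          rcases this with rfl | rfl <;> contradiction
        intro X hX x hx y hy
        rcases Finset.mem_union.1 hX with hX | hX
        · obtain ⟨u, hu, rfl⟩ := Finset.mem_image.1 hX
          rw [mem_bb (Finset.mem_Icc.1 hu).1] at hx hy
          exact hx.2.trans hy.2.symm
        · rcases hm X hX x hx y hy with h | ⟨h, h'⟩ | ⟨h, h'⟩
          · exact h
          · exact (key X hX x hx y hy h h').elim
          · exact (key X hX y hy x hx h' h).elim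
    · exfalso
      obtain ⟨B, hB, hx⟩ := hex (2 * t - 1) (by omega) (by omega)
      have hB4 := hfour B hB _ hx (by omega)
      have hBA : ∀ z ∈ B, z ∉ A := fun z hz hz' => ha (hdis B hB A hA z hz hz' ▸ hx)
      refine not_single (x := 2 * t - 1) (hc B hB) fun z hz => ?_
      have := hBA z hz
      rcases hB4 z hz with rfl | rfl | rfl | rfl <;> first | rfl | contradiction
    · refine ⟨1, by omega, ?_⟩
      obtain ⟨B, hB, hx⟩ := hex (2 * t - 1) (by omega) (by omega)
      have hB4 := hfour B hB _ hx (by omega)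
      have hBA : ∀ z ∈ B, z ∉ A := fun z hz hz' => ha (hdis B hB A hA z hz hz' ▸ hx)
      have e1 : B = {2 * t - 1, 2 * t'} := by
        refine pair_of_card (hc B hB) fun z hz => ?_
        have := hBA z hz
        rcases hB4 z hz with rfl | rfl | rfl | rfl <;> first | simp; done | contradiction
      have e2 : A = {2 * t, 2 * t' - 1} := by
        refine pair_of_card hA2 fun z hz => ?_
        rcases hA4 z hz with rfl | rfl | rfl | rfl <;> first | simp; done | contradiction
      intro X hX
      simp [NN] at hX
      rcases hX with rfl | rfl
      · rw [← e1]; exact hB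
      · rw [← e2]; exact hA
    · refine ⟨0, by omega, ?_⟩
      obtain ⟨B, hB, hx⟩ := hex (2 * t - 1) (by omega) (by omega)
      have hB4 := hfour B hB _ hx (by omega)
      have hBA : ∀ z ∈ B, z ∉ A := fun z hz hz' => ha (hdis B hB A hA z hz hz' ▸ hx)
      have e1 : B = {2 * t - 1, 2 * t' - 1} := by
        refine pair_of_card (hc B hB) fun z hz => ?_
        have := hBA z hz
        rcases hB4 z hz with rfl | rfl | rfl | rfl <;> first | simp; done | contradiction
      have e2 : A = {2 * t, 2 * t'} := by
        refine pair_of_card hA2 fun z hz => ?_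
        rcases hA4 z hz with rfl | rfl | rfl | rfl <;> first | simp; done | contradiction
      intro X hX
      simp [NN] at hX
      rcases hX with rfl | rfl
      · rw [← e1]; exact hB
      · rw [← e2]; exact hA
    · exfalso
      refine not_single (x := 2 * t) hA2 fun z hz => ?_
      rcases hA4 z hz with rfl | rfl | rfl | rfl <;> first | rfl | contradiction
  obtain ⟨i, hi, hN⟩ := hNN
  refine ⟨t, t', i, h1, hside.1, hside.2, h3, hi, ?_⟩
  apply part_eq_of_subset hP (QQ_part h1 h2 h3)
  intro A hA
  rcases (mem_QQ h1 (by omega)).1 hA with ⟨u, u1, u2, u3, u4, rfl⟩ | hA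
  · exact hsing u u1 u2 u3 u4
  · exact hN A hA

lemma good_iff {k₁ k₂ k : ℕ} (hk₁ : 0 < k₁) (hk₂ : 0 < k₂) (hk : k = k₁ + k₂)
    (P : Finset (Finset ℕ)) :
    (P ∈ partitionsOf (Finset.Icc 1 (2 * k)) ∧
    (∀ A ∈ P, 2 ≤ A.card) ∧ joinNumParts (Finset.Icc 1 (2 * k)) (PP k₁ k₂ k) P = 1 ∧
    joinNumParts (Finset.Icc 1 (2 * k)) ((Finset.Icc 1 k).image bb) P = k - 1) ↔
    ∃ t t' i, 1 ≤ t ∧ t ≤ k₁ ∧ k₁ < t' ∧ t' ≤ k ∧ i < 3 ∧ P = QQ k i t t' := by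
  rw [mem_partitionsOf']
  constructor
  · rintro ⟨h1, h2, h3, h4⟩
    exact forward hk₁ hk₂ hk h1 h2 h3 h4
  · rintro ⟨t, t', i, h1, h2, h3, h4, -, rfl⟩
    exact ⟨QQ_part h1 (by omega) h4, fun A hA => QQ_card h1 (by omega) hA,
      QQ_join1 hk h1 h2 h3 h4, QQ_join0 h1 (by omega) h4⟩

lemma bb_mem_QQ {k i t t' u : ℕ} (ht : 1 ≤ t) (htt : t < t') (hu : 1 ≤ u) (huk : u ≤ k) :
    bb u ∈ QQ k i t t' ↔ u ≠ t ∧ u ≠ t' := by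
  rw [mem_QQ ht (by omega)]
  constructor
  · rintro (⟨v, h1, h2, h3, h4, h5⟩ | h)
    · rw [bb_inj hu h1 h5]; exact ⟨h3, h4⟩
    · exfalso
      obtain ⟨x, hx, y, hy, hxy⟩ : ∃ x ∈ bb u, ∃ y ∈ bb u, (x + 1) / 2 ≠ (y + 1) / 2 := by
        generalize bb u = B at h
        unfold NN at h
        split_ifs at h <;> simp only [Finset.mem_insert, Finset.mem_singleton] at h
        · rcases h with rfl | rfl
          · exact ⟨2 * t - 1, by simp, 2 * t' - 1, by simp, by omega⟩
          · exact ⟨2 * t, by simp, 2 * t', by simp, by omega⟩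
        · rcases h with rfl | rfl
          · exact ⟨2 * t - 1, by simp, 2 * t', by simp, by omega⟩
          · exact ⟨2 * t, by simp, 2 * t' - 1, by simp, by omega⟩
        · subst h
          exact ⟨2 * t, by simp, 2 * t', by simp, by omega⟩
      rw [mem_bb hu] at hx hy
      omega
  · rintro ⟨h1, h2⟩
    exact Or.inl ⟨u, hu, huk, h1, h2, rfl⟩

lemma QQ_rel {k i t t' : ℕ} (ht : 1 ≤ t) (htt : t < t') (htk : t' ≤ k) (hi : i < 3) :
    ((∃ A ∈ QQ k i t t', 2 * t ∈ A ∧ 2 * t' ∈ A) ↔ i ≠ 1) ∧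
    ((∃ A ∈ QQ k i t t', 2 * t ∈ A ∧ 2 * t' - 1 ∈ A) ↔ i ≠ 0) := by
  have key : ∀ y, (∃ A ∈ QQ k i t t', 2 * t ∈ A ∧ y ∈ A) ↔ ∃ A ∈ NN i t t', 2 * t ∈ A ∧ y ∈ A := by
    intro y
    constructor
    · rintro ⟨A, hA, h1, h2⟩
      rcases (mem_QQ ht (by omega)).1 hA with ⟨u, u1, u2, u3, u4, rfl⟩ | hA
      · rw [mem_bb u1] at h1; omega
      · exact ⟨A, hA, h1, h2⟩
    · rintro ⟨A, hA, h⟩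
      exact ⟨A, (mem_QQ ht (by omega)).2 (Or.inr hA), h⟩
  rw [key, key]
  interval_cases i <;> simp [NN] <;> omega

lemma QQ_inj {k₁ k i t t' j s s' : ℕ} (ht : 1 ≤ t) (htt : t ≤ k₁) (hkt : k₁ < t') (htk : t' ≤ k)
    (hs : 1 ≤ s) (hss : s ≤ k₁) (hks : k₁ < s') (hsk : s' ≤ k) (hi : i < 3) (hj : j < 3)
    (h : QQ k i t t' = QQ k j s s') : t = s ∧ t' = s' ∧ i = j := by
  have a1 := (bb_mem_QQ (k := k) (i := i) (t' := t') (u := t) ht (by omega) ht (by omega))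
  have a2 := (bb_mem_QQ (k := k) (i := i) (u := t') ht (show t < t' by omega) (by omega) (by omega))
  rw [h, bb_mem_QQ hs (by omega) (by omega) (by omega)] at a1 a2
  have e1 : t = s := by omega
  have e2 : t' = s' := by omega
  subst e1 e2
  have b := QQ_rel (k := k) (i := i) ht (show t < t' by omega) htk hi
  have c := QQ_rel (k := k) (i := j) ht (show t < t' by omega) htk hj
  rw [h, c.1, c.2] at b
  omega

lemma pair_bb {a b u : ℕ} (hu : 1 ≤ u) (hab : a < b) (h : bb u = {a, b}) :
    a = 2 * u - 1 ∧ b = 2 * u := by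
  have h1 : a ∈ bb u := by rw [h]; simp
  have h2 : b ∈ bb u := by rw [h]; simp
  rw [mem_bb hu] at h1 h2
  omega

lemma mem_filter_any {α : Type*} {p : α → Prop} {inst : DecidablePred p} {s : Finset α} {a : α} :
    a ∈ @Finset.filter α p inst s ↔ a ∈ s ∧ p a := Finset.mem_filter

/-- with `k = k₁ + k₂`,
`Π₀ = {{1,2},...,{2k−1,2k}}` and
`Π₁ = {{2,3},...,{2k₁,1},{2k₁+2,2k₁+3},...,{2k,2k₁+1}}` (two cycles), the
partitions `Π ∈ Part₂(2k)` with `#(Π₁ ∨ Π) = 1` and `#(Π₀ ∨ Π) = k − 1` are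
exactly those obtained from a choice of `A = {a₁ < a₂} ∈ Π₀`,
`A ⊆ {1,...,2k₁}`, and `A' = {a₁' < a₂'} ∈ Π₀`, `A' ⊆ {2k₁+1,...,2k}`, in one
of the three ways `(Π₀∖{A,A'}) ∪ {{a₁,a₁'},{a₂,a₂'}}`,
`(Π₀∖{A,A'}) ∪ {{a₁,a₂'},{a₂,a₁'}}`, `(Π₀∖{A,A'}) ∪ {A ∪ A'}`; and there are
exactly `3·k₁·k₂` of them. -/
theorem stmt_16 (k₁ k₂ k : ℕ) (hk₁ : 0 < k₁) (hk₂ : 0 < k₂) (hk : k = k₁ + k₂)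
    (P₀ P₁ : Finset (Finset ℕ))
    (hP₀ : P₀ = (Finset.Icc 1 k).image fun t => ({2 * t - 1, 2 * t} : Finset ℕ))
    (hP₁ : P₁ =
      (((Finset.Icc 1 (k₁ - 1)).image fun t => ({2 * t, 2 * t + 1} : Finset ℕ)) ∪
        {({2 * k₁, 1} : Finset ℕ)}) ∪
      ((((Finset.Icc 1 (k₂ - 1)).image fun t =>
          ({2 * k₁ + 2 * t, 2 * k₁ + 2 * t + 1} : Finset ℕ)) ∪
        {({2 * k, 2 * k₁ + 1} : Finset ℕ)}))) :
    (∀ P ∈ partitionsOf (Finset.Icc 1 (2 * k)),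
      ((∀ A ∈ P, 2 ≤ A.card) ∧ joinNumParts (Finset.Icc 1 (2 * k)) P₁ P = 1 ∧
          joinNumParts (Finset.Icc 1 (2 * k)) P₀ P = k - 1) ↔
        (∃ a₁ a₂ a₁' a₂' : ℕ, a₁ < a₂ ∧ a₁' < a₂' ∧
          ({a₁, a₂} : Finset ℕ) ∈ P₀ ∧ ({a₁', a₂'} : Finset ℕ) ∈ P₀ ∧
          ({a₁, a₂} : Finset ℕ) ⊆ Finset.Icc 1 (2 * k₁) ∧
          ({a₁', a₂'} : Finset ℕ) ⊆ Finset.Icc (2 * k₁ + 1) (2 * k) ∧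
          (P = (P₀ \ {({a₁, a₂} : Finset ℕ), ({a₁', a₂'} : Finset ℕ)}) ∪
              {({a₁, a₁'} : Finset ℕ), ({a₂, a₂'} : Finset ℕ)} ∨
           P = (P₀ \ {({a₁, a₂} : Finset ℕ), ({a₁', a₂'} : Finset ℕ)}) ∪
              {({a₁, a₂'} : Finset ℕ), ({a₂, a₁'} : Finset ℕ)} ∨
           P = (P₀ \ {({a₁, a₂} : Finset ℕ), ({a₁', a₂'} : Finset ℕ)}) ∪
              {({a₁, a₂, a₁', a₂'} : Finset ℕ)}))) ∧
    ((partitionsOf (Finset.Icc 1 (2 * k))).filter fun P =>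
        (∀ A ∈ P, 2 ≤ A.card) ∧ joinNumParts (Finset.Icc 1 (2 * k)) P₁ P = 1 ∧
          joinNumParts (Finset.Icc 1 (2 * k)) P₀ P = k - 1).card = 3 * k₁ * k₂ := by
  have e0 : P₀ = (Finset.Icc 1 k).image bb := hP₀
  have e1 : P₁ = PP k₁ k₂ k := hP₁
  clear hP₀ hP₁
  subst e0 e1
  have good := good_iff hk₁ hk₂ hk
  constructor
  · intro P hP
    have g := good P
    rw [and_iff_right hP] at g
    rw [g]
    constructor
    · rintro ⟨t, t', i, h1, h2, h3, h4, hi, rfl⟩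
      refine ⟨2 * t - 1, 2 * t, 2 * t' - 1, 2 * t', by omega, by omega,
        Finset.mem_image.2 ⟨t, Finset.mem_Icc.2 (by omega), rfl⟩,
        Finset.mem_image.2 ⟨t', Finset.mem_Icc.2 (by omega), rfl⟩, ?_, ?_, ?_⟩
      · intro x hx
        simp only [Finset.mem_insert, Finset.mem_singleton] at hx
        rw [Finset.mem_Icc]; omega
      · intro x hx
        simp only [Finset.mem_insert, Finset.mem_singleton] at hx
        rw [Finset.mem_Icc]; omega
      · interval_cases i
        · exact Or.inl rfl
        · exact Or.inr (Or.inl rfl)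
        · exact Or.inr (Or.inr rfl)
    · rintro ⟨a, b, c, d, hab, hcd, m1, m2, s1, s2, h⟩
      obtain ⟨t, ht, ht'⟩ := Finset.mem_image.1 m1
      obtain ⟨s, hs, hs'⟩ := Finset.mem_image.1 m2
      rw [Finset.mem_Icc] at ht hs
      obtain ⟨rfl, rfl⟩ := pair_bb ht.1 hab ht'
      obtain ⟨rfl, rfl⟩ := pair_bb hs.1 hcd hs'
      have r1 := Finset.mem_Icc.1 (s1 (Finset.mem_insert_self _ _))
      have r2 := Finset.mem_Icc.1 (s2 (Finset.mem_insert_self _ _))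
      have hi : ∃ i < 3, P = QQ k i t s := by
        rcases h with h | h | h
        · exact ⟨0, by omega, h⟩
        · exact ⟨1, by omega, h⟩
        · exact ⟨2, by omega, h⟩
      obtain ⟨i, hi, rfl⟩ := hi
      exact ⟨t, s, i, ht.1, by omega, by omega, hs.2, hi, rfl⟩
  · refine (congrArg Finset.card (a₂ :=
        (Finset.range 3 ×ˢ (Finset.Icc 1 k₁ ×ˢ Finset.Icc (k₁ + 1) k)).image
          (fun p => QQ k p.1 p.2.1 p.2.2)) ?_).trans ?_
    · ext P
      refine mem_filter_any.trans ?_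
      rw [good P]
      simp only [Finset.mem_image, Finset.mem_product, Finset.mem_range, Finset.mem_Icc]
      constructor
      · rintro ⟨t, t', i, h1, h2, h3, h4, hi, rfl⟩
        exact ⟨(i, t, t'), ⟨hi, ⟨h1, h2⟩, h3, h4⟩, rfl⟩
      · rintro ⟨⟨i, t, t'⟩, ⟨hi, ⟨h1, h2⟩, h3, h4⟩, rfl⟩
        exact ⟨t, t', i, h1, h2, h3, h4, hi, rfl⟩
    rw [Finset.card_image_of_injOn]
    · simp only [Finset.card_product, Finset.card_range, Nat.card_Icc]
      rw [show k + 1 - (k₁ + 1) = k₂ by omega, show k₁ + 1 - 1 = k₁ by omega, mul_assoc]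
    · rintro ⟨i, t, t'⟩ h ⟨j, s, s'⟩ h' hh
      simp only [Finset.coe_product, Set.mem_prod, Finset.mem_coe, Finset.mem_range,
        Finset.mem_Icc] at h h'
      obtain ⟨r1, r2, r3⟩ := QQ_inj h.2.1.1 h.2.1.2 h.2.2.1 h.2.2.2 h'.2.1.1 h'.2.1.2 h'.2.2.1
        h'.2.2.2 h.1 h'.1 hh
      rw [r1, r2, r3]
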